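/- Let ε > 0 and let n be an integer with εn ≥ 3. Let H be a 3-uniform hypergraph on n vertices with δ₂(H) ≥ (1/3 + ε)n containing no homomorphic copy of the tight cycle C₁₁. Then every vertex v of H with d_D⁺(v) > 0 satisfies d_B(v) ≥ (1/3 + ε)n, where d_D⁺(v) is the out-degree of v in the apex digraph D and d_B(v) is the degree of v in the base-pair graph B. -/

import Mathlib

open Finset

/-- A 3-uniform hypergraph given by its edge set: every edge has exactly 3 vertices. -/
def IsUniform3 {V : Type*} (H : Finset (Finset V)) : Prop :=
  ∀ e ∈ H, e.card = 3

/-- The codegree of a pair of vertices: the number of vertices `w` with `{u,v,w} ∈ H`. -/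
noncomputable def codeg {V : Type*} [DecidableEq V] (H : Finset (Finset V)) (u v : V) : ℕ :=
  {w : V | ({u, v, w} : Finset V) ∈ H}.ncard

/-- The minimum codegree `δ₂(H)`: the minimum of `codeg H u v` over pairs of distinct vertices. -/
noncomputable def minCodeg {V : Type*} [DecidableEq V] (H : Finset (Finset V)) : ℕ :=
  sInf {d : ℕ | ∃ u v : V, u ≠ v ∧ codeg H u v = d}

/-- `H` contains a homomorphic copy of the tight cycle `C_ℓ`: a cyclic sequence of vertices
(indexed by `ZMod ℓ`, not necessarily distinct) in which every three cyclically consecutive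
vertices are pairwise distinct and form an edge of `H`. -/
def HasHomTightCycle {V : Type*} [DecidableEq V] (ℓ : ℕ) (H : Finset (Finset V)) : Prop :=
  ∃ x : ZMod ℓ → V, ∀ i : ZMod ℓ,
    x (i - 1) ≠ x i ∧ x i ≠ x (i + 1) ∧ x (i - 1) ≠ x (i + 1) ∧
      ({x (i - 1), x i, x (i + 1)} : Finset V) ∈ H

/-- `H` contains a (genuine) copy of the tight cycle `C_ℓ`: `ℓ` distinct vertices, cyclically
ordered, such that every three cyclically consecutive vertices form an edge of `H`. -/
def HasTightCycle {V : Type*} [DecidableEq V] (ℓ : ℕ) (H : Finset (Finset V)) : Prop :=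
  ∃ x : ZMod ℓ → V, Function.Injective x ∧
    ∀ i : ZMod ℓ, ({x (i - 1), x i, x (i + 1)} : Finset V) ∈ H

/-- The arc `u → v` of the apex digraph `D`: some `K₄⁻` of `H` contains `u` and `v`
with apex `v`; i.e. there are two further vertices `a, b` (with `u,v,a,b` distinct)
such that the three edges through `v` on `{u,v,a,b}` all lie in `H`. -/
def ArcD {V : Type*} [DecidableEq V] (H : Finset (Finset V)) (u v : V) : Prop :=
  ∃ a b : V, ({u, v, a, b} : Finset V).card = 4 ∧
    ({v, u, a} : Finset V) ∈ H ∧ ({v, u, b} : Finset V) ∈ H ∧ ({v, a, b} : Finset V) ∈ H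

/-- `{u,v}` is a base pair: some `K₄⁻` of `H` contains `u` and `v` with neither `u` nor
`v` being the apex; i.e. there are further vertices `w, a` (with `u,v,w,a` distinct) with
apex `w`, so that the three edges through `w` on `{u,v,w,a}` all lie in `H`. -/
def BasePair {V : Type*} [DecidableEq V] (H : Finset (Finset V)) (u v : V) : Prop :=
  ∃ w a : V, ({u, v, w, a} : Finset V).card = 4 ∧
    ({w, u, v} : Finset V) ∈ H ∧ ({w, u, a} : Finset V) ∈ H ∧ ({w, v, a} : Finset V) ∈ H

/-- The degree of `v` in the base-pair graph `B`. -/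
noncomputable def degB {V : Type*} [DecidableEq V] (H : Finset (Finset V)) (v : V) : ℕ :=
  {u : V | BasePair H u v}.ncard

/-- The out-degree of `v` in the apex digraph `D`. -/
noncomputable def outDegD {V : Type*} [DecidableEq V] (H : Finset (Finset V)) (v : V) : ℕ :=
  {u : V | ArcD H v u}.ncard

/-- The in-degree of `v` in the apex digraph `D`. -/
noncomputable def inDegD {V : Type*} [DecidableEq V] (H : Finset (Finset V)) (v : V) : ℕ :=
  {u : V | ArcD H u v}.ncard

/-- The codegree Turán number `ex₂(n, C_ℓ)`: the maximum of `δ₂(H)` over all 3-uniform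
hypergraphs `H` on `n` vertices containing no copy of the tight cycle `C_ℓ`. -/
noncomputable def exCodeg (ℓ n : ℕ) : ℕ :=
  sSup {k : ℕ | ∃ H : Finset (Finset (Fin n)),
    IsUniform3 H ∧ ¬ HasTightCycle ℓ H ∧ minCodeg H = k}

section TightCycles

variable {V : Type*} [DecidableEq V] {H : Finset (Finset V)}

lemma IsUniform3.ne_of_mem (hH : IsUniform3 H) {x y z : V} (h : ({x, y, z} : Finset V) ∈ H) :
    x ≠ y ∧ y ≠ z ∧ x ≠ z := by
  have h3 := Finset.card_eq_three.mp (hH _ h)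
  have hc := hH _ h
  refine ⟨?_, ?_, ?_⟩ <;> rintro rfl
  · have := Finset.card_le_two (a := x) (b := z); simp at hc; omega
  · have := Finset.card_le_two (a := x) (b := y); simp at hc; omega
  · have := Finset.card_le_two (a := y) (b := x)
    rw [Finset.insert_eq_of_mem (by simp)] at hc; omega

lemma insert_rotate (x y z : V) : ({x, y, z} : Finset V) = {y, z, x} := by
  ext; simp; tauto

lemma insert_swap (x y z : V) : ({x, y, z} : Finset V) = {y, x, z} := by
  ext; simp; tauto

/-- In a 3-uniform hypergraph, the distinctness conditions on a homomorphic `C₁₁` are automatic. -/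
lemma hasHomTightCycle_eleven (hH : IsUniform3 H) (x : Fin 11 → V)
    (hx : ∀ i : Fin 11, ({x (i - 1), x i, x (i + 1)} : Finset V) ∈ H) :
    HasHomTightCycle 11 H :=
  ⟨x, fun i ↦
    have h := hH.ne_of_mem (hx i)
    ⟨h.1, h.2.1, h.2.2, hx i⟩⟩

/-- The apex digraph has no 2-cycles in the absence of a homomorphic `C₁₁`. -/
lemma ArcD.asymm (hH : IsUniform3 H) (hfree : ¬ HasHomTightCycle 11 H) {u v : V}
    (huv : ArcD H u v) : ¬ ArcD H v u := by
  rintro ⟨a, b, -, h₁, h₂, h₃⟩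
  obtain ⟨c, d, -, h₄, h₅, h₆⟩ := huv
  refine hfree (hasHomTightCycle_eleven hH ![v, u, b, v, u, b, a, u, v, d, c] fun i ↦ ?_)
  fin_cases i <;> simp <;> grind [insert_rotate, insert_swap]

/-- The apex digraph and the base-pair graph are disjoint in the absence of a homomorphic `C₁₁`. -/
lemma ArcD.not_basePair (hH : IsUniform3 H) (hfree : ¬ HasHomTightCycle 11 H) {u v : V}
    (hvu : ArcD H v u) : ¬ BasePair H u v := by
  rintro ⟨w, c, -, h₁, h₂, h₃⟩
  obtain ⟨a, b, -, h₄, h₅, h₆⟩ := hvu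
  refine hfree (hasHomTightCycle_eleven hH ![u, v, b, u, a, v, u, w, c, v, w] fun i ↦ ?_)
  fin_cases i <;> simp <;> grind [insert_rotate, insert_swap]

lemma minCodeg_le_codeg {u v : V} (h : u ≠ v) : minCodeg H ≤ codeg H u v :=
  Nat.sInf_le ⟨u, v, h, rfl⟩

/-- If the codegrees exceed a third of the number of vertices, then every edge `{x, y, z}` has
two pairs with a common neighbour. -/
lemma exists_common_neighbor [Fintype V] (hH : IsUniform3 H)
    (hδ : Fintype.card V < 3 * minCodeg H) {x y z : V} (h : ({x, y, z} : Finset V) ∈ H) :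
    ∃ w, ({x, y, w} ∈ H ∧ {x, z, w} ∈ H) ∨ ({y, x, w} ∈ H ∧ {y, z, w} ∈ H) ∨
      ({z, x, w} ∈ H ∧ {z, y, w} ∈ H) := by
  classical
  by_contra! hcon
  obtain ⟨hxy, hyz, hxz⟩ := hH.ne_of_mem h
  have key (u v : V) (huv : u ≠ v) :
      minCodeg H ≤ (univ.filter fun w ↦ ({u, v, w} : Finset V) ∈ H).card := by
    refine (minCodeg_le_codeg huv).trans_eq ?_
    rw [codeg, ← Set.ncard_coe_finset]
    simp
  have h₁ : Disjoint (univ.filter fun w ↦ ({x, y, w} : Finset V) ∈ H)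
      (univ.filter fun w ↦ ({x, z, w} : Finset V) ∈ H) :=
    disjoint_filter.2 fun w _ ha hb ↦ (hcon w).1 ha hb
  have h₂ : Disjoint ((univ.filter fun w ↦ ({x, y, w} : Finset V) ∈ H) ∪
      (univ.filter fun w ↦ ({x, z, w} : Finset V) ∈ H))
      (univ.filter fun w ↦ ({y, z, w} : Finset V) ∈ H) := by
    refine disjoint_union_left.2 ⟨disjoint_filter.2 fun w _ ha hb ↦ ?_,
      disjoint_filter.2 fun w _ ha hb ↦ ?_⟩
    · exact (hcon w).2.1 (insert_swap x y w ▸ ha) hb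
    · exact (hcon w).2.2 (insert_swap x z w ▸ ha) (insert_swap y z w ▸ hb)
  have := card_le_univ (((univ.filter fun w ↦ ({x, y, w} : Finset V) ∈ H) ∪
      (univ.filter fun w ↦ ({x, z, w} : Finset V) ∈ H)) ∪
      (univ.filter fun w ↦ ({y, z, w} : Finset V) ∈ H))
  rw [card_union_of_disjoint h₂, card_union_of_disjoint h₁] at this
  have := key x y hxy
  have := key x z hxz
  have := key y z hyz
  omega

/-- Three edges `{x, y, z}`, `{x, y, w}`, `{x, z, w}` form a `K₄⁻` with apex `x`. -/
lemma IsUniform3.arcD_and_basePair (hH : IsUniform3 H) {x y z w : V}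
    (h₁ : ({x, y, z} : Finset V) ∈ H) (h₂ : ({x, y, w} : Finset V) ∈ H)
    (h₃ : ({x, z, w} : Finset V) ∈ H) : ArcD H y x ∧ BasePair H y z := by
  have := hH.ne_of_mem h₁
  have := hH.ne_of_mem h₂
  have := hH.ne_of_mem h₃
  exact ⟨⟨z, w, by grind, h₁, h₂, h₃⟩, ⟨x, w, by grind, h₁, h₂, h₃⟩⟩

/-- If `v → u`, then every neighbour of the pair `{u, v}` forms a base pair with `v`. -/
lemma ArcD.basePair_of_mem [Fintype V] (hH : IsUniform3 H)
    (hδ : Fintype.card V < 3 * minCodeg H) (hfree : ¬ HasHomTightCycle 11 H) {u v w : V}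
    (hvu : ArcD H v u) (h : ({u, v, w} : Finset V) ∈ H) : BasePair H w v := by
  obtain ⟨t, ⟨h₁, h₂⟩ | ⟨h₁, h₂⟩ | ⟨h₁, h₂⟩⟩ := exists_common_neighbor hH hδ h
  · exact (hH.arcD_and_basePair (by grind [insert_rotate, insert_swap]) h₂ h₁).2
  · exact absurd (hH.arcD_and_basePair (by grind [insert_swap]) h₁ h₂).1 (hvu.asymm hH hfree)
  · exact absurd (hH.arcD_and_basePair (by grind [insert_rotate]) h₁ h₂).2
      (hvu.not_basePair hH hfree)

end TightCycles

/-- If `ε > 0`, `εn ≥ 3` and `H` is a 3-uniform hypergraph on `n` vertices with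
`δ₂(H) ≥ (1/3 + ε)n` and no homomorphic copy of `C₁₁`, then every vertex `v` with
`d_D⁺(v) > 0` satisfies `d_B(v) ≥ (1/3 + ε)n`. -/
theorem outDegD_pos_imp_degB_large {n : ℕ} (ε : ℝ) (hε : 0 < ε) (hεn : (3 : ℝ) ≤ ε * n)
    (H : Finset (Finset (Fin n))) (hH : IsUniform3 H)
    (hδ : ((1 / 3 : ℝ) + ε) * n ≤ (minCodeg H : ℝ))
    (hfree : ¬ HasHomTightCycle 11 H) :
    ∀ v : Fin n, 0 < outDegD H v → ((1 / 3 : ℝ) + ε) * n ≤ (degB H v : ℝ) := by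
  intro v hv
  obtain ⟨u, hu⟩ := Set.nonempty_of_ncard_ne_zero hv.ne'
  have hcard : Fintype.card (Fin n) < 3 * minCodeg H := by
    rw [Fintype.card_fin]
    have : (n : ℝ) < 3 * minCodeg H := by linarith
    exact_mod_cast this
  have huv : u ≠ v := by
    obtain ⟨a, b, -, h, -⟩ := hu
    exact (hH.ne_of_mem h).1
  have hle : codeg H u v ≤ degB H v :=
    Set.ncard_le_ncard fun w hw ↦ ArcD.basePair_of_mem hH hcard hfree hu hw
  exact hδ.trans (by exact_mod_cast (minCodeg_le_codeg huv).trans hle)
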